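/- arXiv:2107.02755 — 4 statements merged into one kernel-verified Lean document; each statement's English description precedes it below -/
import Mathlib

section
/- Let E be a real Hilbert space, λ > 0, μ > 0, and let F_1, …, F_J : E → ℝ be differentiable functions such that each F_j is λ-strongly convex and μ-smooth and attains a global minimum value F_j*. Let w* be a global minimizer of F̄ := (1/J)·Σ_{j=1}^J F_j, and set ε_j := F_j(w*) − F_j* (so ε_j ≥ 0). Then for all points w_1, …, w_J, w̄ ∈ E and every step size η with 0 < η ≤ 1/(4μ): ‖w̄ − w* − η·(1/J)·Σ_{j=1}^J ∇F_j(w_j)‖² ≤ (1 − λη/2)·‖w̄ − w*‖² + (2 + λ/(4μ))·(1/J)·Σ_{j=1}^J ‖w̄ − w_j‖² + 6μη²·(1/J)·Σ_{j=1}^J ε_j. (Deterministic one-step contraction at the core of the paper's Lemma 3, obtained when the gradients are evaluated on the full data; the additional nonpositive term 2η·(1/J)·Σ_j(F_j(w*) − F_j(w̄)) appearing in the paper's statement has been dropped.) -/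
open MeasureTheory
open scoped RealInnerProductSpace

section SmoothConvex

variable {E : Type*} [NormedAddCommGroup E] [InnerProductSpace ℝ E] [CompleteSpace E]

/-- The quadratic upper bound for a differentiable function with `μ`-Lipschitz gradient. -/
lemma le_quadratic_of_lipschitz_gradient {f : E → ℝ} {μ : ℝ} (hf : Differentiable ℝ f)
    (hsmooth : ∀ x y, ‖gradient f x - gradient f y‖ ≤ μ * ‖x - y‖) (x v : E) :
    f (x + v) ≤ f x + ⟪gradient f x, v⟫ + μ / 2 * ‖v‖ ^ 2 := by
  let h : ℝ → ℝ := fun t => f (x + t • v) - (t * ⟪gradient f x, v⟫ + μ / 2 * ‖v‖ ^ 2 * t ^ 2)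
  have hderiv (t : ℝ) : HasDerivAt h
      (⟪gradient f (x + t • v), v⟫ - (⟪gradient f x, v⟫ + μ * ‖v‖ ^ 2 * t)) t := by
    have hline : HasDerivAt (fun t : ℝ => x + t • v) v t := by
      simpa using ((hasDerivAt_id t).smul_const v).const_add x
    have hcomp : HasDerivAt (fun t : ℝ => f (x + t • v)) ⟪gradient f (x + t • v), v⟫ t := by
      refine ((hf (x + t • v)).hasFDerivAt.comp_hasDerivAt t hline).congr_deriv ?_
      simp
    have hquad := ((hasDerivAt_id t).mul_const ⟪gradient f x, v⟫).add
      ((hasDerivAt_pow 2 t).const_mul (μ / 2 * ‖v‖ ^ 2))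
    refine (hcomp.sub hquad).congr_deriv ?_
    simp
    ring
  have hanti : AntitoneOn h (Set.Ici 0) := by
    refine antitoneOn_of_deriv_nonpos (convex_Ici 0)
      (fun t _ => (hderiv t).continuousAt.continuousWithinAt)
      (fun t _ => (hderiv t).differentiableAt.differentiableWithinAt) fun t ht => ?_
    rw [interior_Ici] at ht
    rw [(hderiv t).deriv]
    have hlip := hsmooth (x + t • v) x
    rw [add_sub_cancel_left, norm_smul, Real.norm_of_nonneg (le_of_lt ht)] at hlip
    have hcs := real_inner_le_norm (gradient f (x + t • v) - gradient f x) v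
    rw [inner_sub_left] at hcs
    nlinarith [mul_le_mul_of_nonneg_right hlip (norm_nonneg v)]
  have h01 := hanti (Set.mem_Ici.2 le_rfl) (Set.mem_Ici.2 zero_le_one) zero_le_one
  simp only [h, one_smul, zero_smul, add_zero] at h01
  linarith

/-- The squared gradient is controlled by the suboptimality gap. -/
lemma norm_gradient_sq_le {f : E → ℝ} {μ m : ℝ} (hμ : 0 < μ) (hf : Differentiable ℝ f)
    (hsmooth : ∀ x y, ‖gradient f x - gradient f y‖ ≤ μ * ‖x - y‖) (hm : ∀ x, m ≤ f x) (x : E) :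
    ‖gradient f x‖ ^ 2 ≤ 2 * μ * (f x - m) := by
  have hstep := le_quadratic_of_lipschitz_gradient hf hsmooth x (-(μ⁻¹ • gradient f x))
  rw [inner_neg_right, inner_smul_right, real_inner_self_eq_norm_sq, norm_neg, norm_smul,
    Real.norm_of_nonneg (inv_nonneg.2 hμ.le)] at hstep
  have hdecrease : m ≤ f x - ‖gradient f x‖ ^ 2 / (2 * μ) := by
    refine (hm _).trans (hstep.trans_eq ?_)
    field_simp
    ring
  have hdiv : ‖gradient f x‖ ^ 2 / (2 * μ) ≤ f x - m := by linarith
  rw [div_le_iff₀ (by positivity)] at hdiv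
  linarith

/-- One gradient step along `∇f z`, started from `y` instead of `z` and compared with `p`. -/
lemma inexact_gradient_step_le {f : E → ℝ} {lam μ m η : ℝ} (hlam : 0 < lam) (hμ : 0 < μ)
    (hf : Differentiable ℝ f)
    (hsc : ∀ x y, f x ≥ f y + ⟪gradient f y, x - y⟫ + (lam / 2) * ‖x - y‖ ^ 2)
    (hsmooth : ∀ x y, ‖gradient f x - gradient f y‖ ≤ μ * ‖x - y‖) (hm : ∀ x, m ≤ f x)
    (hη0 : 0 < η) (hη : η ≤ 1 / (4 * μ)) (y z p : E) :
    ‖y - p - η • gradient f z‖ ^ 2 ≤ (1 - lam * η / 2) * ‖y - p‖ ^ 2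
      + (2 + lam / (4 * μ)) * ‖y - z‖ ^ 2 + 6 * μ * η ^ 2 * (f p - m)
      - 2 * η * (1 - 2 * μ * η) * (1 - μ * η) * (f y - f p) := by
  have hμη : μ * η ≤ 1 / 4 := by
    calc μ * η ≤ μ * (1 / (4 * μ)) := by gcongr
      _ = 1 / 4 := by field_simp
  have hlamη : lam * η ≤ lam / (4 * μ) := by
    calc lam * η ≤ lam * (1 / (4 * μ)) := by gcongr
      _ = lam / (4 * μ) := by ring
  have hexpand : ‖y - p - η • gradient f z‖ ^ 2 = ‖y - p‖ ^ 2
      - 2 * η * (⟪gradient f z, y - z⟫ - ⟪gradient f z, p - z⟫) + η ^ 2 * ‖gradient f z‖ ^ 2 := by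
    rw [norm_sub_sq_real, inner_smul_right, norm_smul, mul_pow, Real.norm_eq_abs, sq_abs,
      ← inner_sub_right, sub_sub_sub_cancel_right, real_inner_comm]
    ring
  have hyoung (g d : E) : -(2 * η * ⟪g, d⟫) ≤ ‖d‖ ^ 2 + η ^ 2 * ‖g‖ ^ 2 := by
    have := sq_nonneg ‖d + η • g‖
    rw [norm_add_sq_real, inner_smul_right, norm_smul, mul_pow, Real.norm_eq_abs, sq_abs,
      real_inner_comm] at this
    linarith
  have hpar : ‖y - p‖ ^ 2 ≤ 2 * ‖y - z‖ ^ 2 + 2 * ‖p - z‖ ^ 2 := by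
    have := parallelogram_law_with_norm ℝ (y - z) (p - z)
    rw [sub_sub_sub_cancel_right] at this
    nlinarith [sq_nonneg ‖y - z + (p - z)‖]
  have hgap : 2 * η * (f y - f z) ≤ ‖y - z‖ ^ 2 + 2 * μ * η ^ 2 * (f y - m) := by
    have hy := hyoung (gradient f y) (z - y)
    rw [norm_sub_rev z y] at hy
    have hconv := hsc z y
    have hpos : 0 ≤ lam / 2 * ‖z - y‖ ^ 2 := by positivity
    have hgrad := norm_gradient_sq_le hμ hf hsmooth hm y
    nlinarith [mul_le_mul_of_nonneg_left hgrad (sq_nonneg η),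
      mul_le_mul_of_nonneg_left (show f y - f z ≤ -⟪gradient f y, z - y⟫ by linarith) hη0.le]
  have hfactor : 0 ≤ 1 - 2 * μ * η := by linarith
  have hgap_scaled := mul_le_mul_of_nonneg_left hgap hfactor
  have hgrad := mul_le_mul_of_nonneg_left (norm_gradient_sq_le hμ hf hsmooth hm z) (sq_nonneg η)
  have hconv := mul_le_mul_of_nonneg_left (hsc p z) hη0.le
  have hpar_scaled := mul_le_mul_of_nonneg_left hpar (mul_nonneg hlam.le hη0.le)
  have hdist := mul_le_mul_of_nonneg_right hlamη (sq_nonneg ‖y - z‖)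
  have hdrop : 0 ≤ 2 * μ * η * ‖y - z‖ ^ 2 := by positivity
  have heps : 0 ≤ μ * η ^ 2 * (μ * η) * (f p - m) :=
    mul_nonneg (by positivity) (sub_nonneg.2 (hm p))
  have hyz := hyoung (gradient f z) (y - z)
  rw [hexpand]
  linarith

end SmoothConvex

/-- Convexity of the squared norm, for a uniform average. -/
lemma norm_sq_average_le {E : Type*} [NormedAddCommGroup E] [InnerProductSpace ℝ E]
    {J : ℕ} (hJ : 0 < J) (v : Fin J → E) :
    ‖(1 / (J : ℝ)) • ∑ j, v j‖ ^ 2 ≤ (1 / (J : ℝ)) * ∑ j, ‖v j‖ ^ 2 := by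
  have hJ' : (0 : ℝ) < J := Nat.cast_pos.2 hJ
  have hsum : ‖∑ j, v j‖ ^ 2 ≤ J * ∑ j, ‖v j‖ ^ 2 := by
    calc ‖∑ j, v j‖ ^ 2 ≤ (∑ j, ‖v j‖) ^ 2 := by gcongr; exact norm_sum_le _ _
      _ ≤ J * ∑ j, ‖v j‖ ^ 2 := by
        simpa using sq_sum_le_card_mul_sum_sq (s := Finset.univ) (f := fun j => ‖v j‖)
  rw [norm_smul, mul_pow, Real.norm_of_nonneg (by positivity)]
  calc (1 / (J : ℝ)) ^ 2 * ‖∑ j, v j‖ ^ 2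
      ≤ (1 / (J : ℝ)) ^ 2 * (J * ∑ j, ‖v j‖ ^ 2) := by gcongr
    _ = (1 / (J : ℝ)) * ∑ j, ‖v j‖ ^ 2 := by field_simp

/-- Deterministic one-step contraction at the core of the paper's Lemma 3:
for `λ`-strongly convex, `μ`-smooth functions `F j` attaining minimum value
`Fstar j`, with `w*` a global minimizer of the average `F̄`, `ε j = F j w* - Fstar j`,
and step size `0 < η ≤ 1/(4μ)`, one has
`‖w̄ - w* - η (1/J) ∑ ∇F j (w j)‖² ≤ (1 - λη/2)‖w̄ - w*‖²
  + (2 + λ/(4μ)) (1/J) ∑ ‖w̄ - w j‖² + 6μη² (1/J) ∑ ε j`. -/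
theorem fedfog_lemma3_core
    {E : Type*} [NormedAddCommGroup E] [InnerProductSpace ℝ E] [CompleteSpace E]
    (J : ℕ) (hJ : 0 < J) (lam mu : ℝ) (hlam : 0 < lam) (hmu : 0 < mu)
    (F : Fin J → E → ℝ) (Fstar : Fin J → ℝ)
    (hdiff : ∀ j, Differentiable ℝ (F j))
    (hsc : ∀ j w w', F j w ≥
      F j w' + ⟪gradient (F j) w', w - w'⟫ + (lam / 2) * ‖w - w'‖ ^ 2)
    (hsmooth : ∀ j w w', ‖gradient (F j) w - gradient (F j) w'‖ ≤ mu * ‖w - w'‖)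
    (hmin : ∀ j w, Fstar j ≤ F j w)
    (hattain : ∀ j, ∃ w, F j w = Fstar j)
    (wstar : E)
    (hwstar : ∀ w, (1 / (J : ℝ)) * ∑ j, F j wstar ≤ (1 / (J : ℝ)) * ∑ j, F j w)
    (ε : Fin J → ℝ) (hε : ∀ j, ε j = F j wstar - Fstar j)
    (w : Fin J → E) (wbar : E) (η : ℝ) (hη0 : 0 < η) (hη : η ≤ 1 / (4 * mu)) :
    ‖wbar - wstar - η • ((1 / (J : ℝ)) • ∑ j, gradient (F j) (w j))‖ ^ 2
      ≤ (1 - lam * η / 2) * ‖wbar - wstar‖ ^ 2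
        + (2 + lam / (4 * mu)) * ((1 / (J : ℝ)) * ∑ j, ‖wbar - w j‖ ^ 2)
        + 6 * mu * η ^ 2 * ((1 / (J : ℝ)) * ∑ j, ε j) := by
  have hJ' : (0 : ℝ) < J := Nat.cast_pos.2 hJ
  have hμη : mu * η ≤ 1 / 4 := by
    calc mu * η ≤ mu * (1 / (4 * mu)) := by gcongr
      _ = 1 / 4 := by field_simp
  have havg : wbar - wstar - η • ((1 / (J : ℝ)) • ∑ j, gradient (F j) (w j))
      = (1 / (J : ℝ)) • ∑ j, (wbar - wstar - η • gradient (F j) (w j)) := by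
    rw [Finset.sum_sub_distrib, ← Finset.smul_sum, smul_sub, smul_comm η, Finset.sum_const,
      Finset.card_univ, Fintype.card_fin, ← Nat.cast_smul_eq_nsmul ℝ, smul_smul (1 / (J : ℝ)) (J : ℝ),
      one_div_mul_cancel hJ'.ne', one_smul]
  have hstep := Finset.sum_le_sum fun j (_ : j ∈ Finset.univ) =>
    inexact_gradient_step_le hlam hmu (hdiff j) (hsc j) (hsmooth j) (hmin j) hη0 hη
      wbar (w j) wstar
  have hscaled := mul_le_mul_of_nonneg_left hstep (one_div_nonneg.2 hJ'.le)
  have hoptimal := mul_le_mul_of_nonneg_left (hwstar wbar)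
    (show 0 ≤ 2 * η * (1 - 2 * mu * η) * (1 - mu * η) from
      mul_nonneg (mul_nonneg (by positivity) (by linarith)) (by linarith))
  rw [havg]
  refine (norm_sq_average_le hJ _).trans (hscaled.trans ?_)
  simp only [hε, Finset.sum_add_distrib, Finset.sum_sub_distrib, ← Finset.mul_sum,
    Finset.sum_const, Finset.card_univ, Fintype.card_fin, nsmul_eq_mul]
  have hcancel : 1 / (J : ℝ) * J = 1 := one_div_mul_cancel hJ'.ne'
  linear_combination hoptimal + (1 - lam * η / 2) * ‖wbar - wstar‖ ^ 2 * hcancel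
end

section
/- Let λ > 0 be a real number, L ≥ 1 an integer, Θ ≥ 0 a real number, and ψ a real number with ψ ≥ 4L. Let Q : ℕ → ℝ be a sequence with Q(g) ≥ 0 for all g, satisfying for every g ≥ 0 the recursion Q(g+1) ≤ (1 − η_g·λ·L/8)·Q(g) + η_g²·Θ, where η_g := 16/(λ·(g + 1 + ψ)). Then for every G ≥ 0: Q(G) ≤ (ψ²·Q(0) + (256/λ²)·G·Θ)/(G + ψ)². (This is the convergence bound of the paper's Theorem 1 in sum form: the paper states the numerator as max{ψ²·Q(0), (256/λ²)·G·Θ}, and the sum bound is of the same order since the sum is at most twice the maximum; applied with Q(g) = E‖w^g − w*‖² it gives the O(1/G) convergence of FedFog.) -/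
/-- Convergence bound of the paper's Theorem 1 (sum form): if a nonnegative
sequence `Q` satisfies `Q (g+1) ≤ (1 - η_g λ L / 8) Q g + η_g² Θ` with
`η_g = 16 / (λ (g + 1 + ψ))` and `ψ ≥ 4 L`, then
`Q G ≤ (ψ² Q 0 + (256/λ²) G Θ) / (G + ψ)²` for every `G`. -/
theorem fedfog_theorem1
    (lam : ℝ) (hlam : 0 < lam) (L : ℕ) (hL : 1 ≤ L)
    (Θ : ℝ) (hΘ : 0 ≤ Θ) (ψ : ℝ) (hψ : 4 * (L : ℝ) ≤ ψ)
    (Q : ℕ → ℝ) (hQ : ∀ g, 0 ≤ Q g)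
    (hrec : ∀ g : ℕ,
      Q (g + 1) ≤ (1 - (16 / (lam * ((g : ℝ) + 1 + ψ))) * lam * (L : ℝ) / 8) * Q g
        + (16 / (lam * ((g : ℝ) + 1 + ψ))) ^ 2 * Θ) :
    ∀ G : ℕ, Q G ≤ (ψ ^ 2 * Q 0 + (256 / lam ^ 2) * (G : ℝ) * Θ) / ((G : ℝ) + ψ) ^ 2 := by
  intro G
  have hL' : (1 : ℝ) ≤ L := by exact_mod_cast hL
  have hψ0 : 0 < ψ := by linarith
  rw [le_div_iff₀ (by positivity)]
  induction G with
  | zero => simp [mul_comm]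
  | succ g ih =>
    have ht : 0 < (g : ℝ) + 1 + ψ := by positivity
    have hstep : Q (g + 1) * ((g : ℝ) + 1 + ψ) ^ 2 ≤
        (((g : ℝ) + 1 + ψ) ^ 2 - 2 * L * ((g : ℝ) + 1 + ψ)) * Q g + 256 / lam ^ 2 * Θ := by
      refine (mul_le_mul_of_nonneg_right (hrec g) (sq_nonneg _)).trans_eq ?_
      field_simp
      ring
    have hcontract : (((g : ℝ) + 1 + ψ) ^ 2 - 2 * L * ((g : ℝ) + 1 + ψ)) * Q g ≤
        Q g * ((g : ℝ) + ψ) ^ 2 := by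
      rw [mul_comm]
      refine mul_le_mul_of_nonneg_left ?_ (hQ g)
      nlinarith [mul_le_mul_of_nonneg_right hL' ht.le]
    push_cast
    linarith
end

section
/- The function f(x, y) := (1/x)·log(1 + 1/y) is convex on the open positive orthant {(x, y) ∈ ℝ² : x > 0 and y > 0}. (The convexity claim stated in Section IV of the paper for the function (1/β̃)·log(1 + 1/ω) appearing in the uplink-rate constraint (31a), verified there by checking the Hessian matrix.) -/
theorem mul_mul_three_sub_add_le_one {a b : ℝ} (ha : 0 < a) (hb : 0 < b) :
    a * b * (3 - (a + b)) ≤ 1 := by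
  rcases le_total 3 b with h | h
  · nlinarith [mul_pos ha hb, mul_pos (mul_pos ha hb) ha, mul_nonneg (mul_pos ha hb).le
      (sub_nonneg.2 h)]
  · have key : 0 ≤ 4 * b * (1 - a * b * (3 - (a + b))) := by
      have : 4 * b * (1 - a * b * (3 - (a + b)))
          = (2 * b * a + b ^ 2 - 3 * b) ^ 2 + b * (b - 1) ^ 2 * (4 - b) := by ring
      rw [this]
      have : 0 ≤ 4 - b := by linarith
      positivity
    linarith [nonneg_of_mul_nonneg_right key (by positivity)]

/-- The tangent plane of `(x, y) ↦ 1 / (x * y)` at `(u, v)` lies below its graph. -/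
theorem tangent_le_one_div_mul {x y u v : ℝ} (hx : 0 < x) (hy : 0 < y) (hu : 0 < u)
    (hv : 0 < v) : 1 / (u * v) * (3 - (x / u + y / v)) ≤ 1 / (x * y) := by
  rw [le_div_iff₀ (mul_pos hx hy)]
  calc 1 / (u * v) * (3 - (x / u + y / v)) * (x * y)
      = x / u * (y / v) * (3 - (x / u + y / v)) := by ring
    _ ≤ 1 := mul_mul_three_sub_add_le_one (div_pos hx hu) (div_pos hy hv)

theorem convex_positive_orthant : Convex ℝ {p : ℝ × ℝ | 0 < p.1 ∧ 0 < p.2} :=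
  (convex_Ioi (0 : ℝ)).prod (convex_Ioi (0 : ℝ))

theorem convexOn_one_div_mul :
    ConvexOn ℝ {p : ℝ × ℝ | 0 < p.1 ∧ 0 < p.2} (fun p : ℝ × ℝ => 1 / (p.1 * p.2)) := by
  refine ⟨convex_positive_orthant, ?_⟩
  rintro p hp q hq a b ha hb hab
  obtain ⟨hu, hv⟩ := convex_positive_orthant hp hq ha hb hab
  have h₁ := mul_le_mul_of_nonneg_left (tangent_le_one_div_mul hp.1 hp.2 hu hv) ha
  have h₂ := mul_le_mul_of_nonneg_left (tangent_le_one_div_mul hq.1 hq.2 hu hv) hb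
  simp only [Prod.fst_add, Prod.snd_add, Prod.smul_fst, Prod.smul_snd, smul_eq_mul]
    at hu hv h₁ h₂ ⊢
  set u := a * p.1 + b * q.1 with hu_def
  set v := a * p.2 + b * q.2 with hv_def
  have hsum : a * (1 / (u * v) * (3 - (p.1 / u + p.2 / v)))
      + b * (1 / (u * v) * (3 - (q.1 / u + q.2 / v)))
      = 1 / (u * v) * (3 * (a + b) - (u / u + v / v)) := by
    rw [show u / u = (a * p.1 + b * q.1) / u by rw [← hu_def],
      show v / v = (a * p.2 + b * q.2) / v by rw [← hv_def]]
    ring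
  rw [hab, div_self hu.ne', div_self hv.ne'] at hsum
  linarith

theorem continuousOn_one_div_mul_add {x y : ℝ} (hx : 0 < x) (hy : 0 < y) :
    ContinuousOn (fun t : ℝ => 1 / (x * (y + t))) (Set.uIcc 0 1) := by
  refine ContinuousOn.div (by fun_prop) (by fun_prop) fun t ht => ?_
  rw [Set.uIcc_of_le zero_le_one] at ht
  have : 0 < y + t := by linarith [ht.1]
  positivity

theorem one_div_mul_log_eq_integral {x y : ℝ} (hy : 0 < y) :
    1 / x * Real.log (1 + 1 / y) = ∫ t in (0 : ℝ)..1, 1 / (x * (y + t)) := by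
  simp_rw [one_div_mul_eq_div, ← one_div_mul_one_div]
  rw [intervalIntegral.integral_const_mul,
    intervalIntegral.integral_comp_add_left (fun t => 1 / t) y,
    integral_one_div_of_pos (by linarith) (by linarith), add_zero, add_div, div_self hy.ne']
  ring

/-- Convexity claim from Section IV of the paper: `(x, y) ↦ (1/x) log(1 + 1/y)`
is convex on the open positive orthant. -/
theorem fedfog_rate_function_convex :
    ConvexOn ℝ {p : ℝ × ℝ | 0 < p.1 ∧ 0 < p.2}
      (fun p : ℝ × ℝ => (1 / p.1) * Real.log (1 + 1 / p.2)) := by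
  refine ⟨convex_positive_orthant, ?_⟩
  rintro p hp q hq a b ha hb hab
  have hr := convex_positive_orthant hp hq ha hb hab
  have hip := (continuousOn_one_div_mul_add hp.1 hp.2).intervalIntegrable
    (μ := MeasureTheory.volume)
  have hiq := (continuousOn_one_div_mul_add hq.1 hq.2).intervalIntegrable
    (μ := MeasureTheory.volume)
  have hir := (continuousOn_one_div_mul_add hr.1 hr.2).intervalIntegrable
    (μ := MeasureTheory.volume)
  simp only [smul_eq_mul]
  rw [one_div_mul_log_eq_integral hp.2, one_div_mul_log_eq_integral hq.2,
    one_div_mul_log_eq_integral hr.2, ← intervalIntegral.integral_const_mul,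
    ← intervalIntegral.integral_const_mul,
    ← intervalIntegral.integral_add (hip.const_mul a) (hiq.const_mul b)]
  refine intervalIntegral.integral_mono_on zero_le_one hir
    ((hip.const_mul a).add (hiq.const_mul b)) fun t ht => ?_
  have h := convexOn_one_div_mul.2 (x := (p.1, p.2 + t)) ⟨hp.1, add_pos_of_pos_of_nonneg hp.2 ht.1⟩
    (y := (q.1, q.2 + t)) ⟨hq.1, add_pos_of_pos_of_nonneg hq.2 ht.1⟩ ha hb hab
  simp only [Prod.fst_add, Prod.snd_add, Prod.smul_fst, Prod.smul_snd, smul_eq_mul] at h ⊢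
  have ht_eq : a * (p.2 + t) + b * (q.2 + t) = a * p.2 + b * q.2 + t := by
    linear_combination t * hab
  rwa [ht_eq] at h
end

section
/- For all real numbers x > 0, y > 0, x₀ > 0, y₀ > 0, the following inequality holds: (1/x)·log(1 + 1/y) ≥ a − b·y − c·x, where a := (2/x₀)·log(1 + 1/y₀) + 1/(x₀·(y₀ + 1)), b := 1/(x₀·y₀·(y₀ + 1)), and c := (1/x₀²)·log(1 + 1/y₀). (The concave lower-bound inequality (33) used by the paper's inner-approximation Algorithm 2 to convexify the uplink-rate constraint; it is the first-order Taylor lower bound of the jointly convex function (x, y) ↦ (1/x)·log(1 + 1/y) at the feasible point (x₀, y₀).) -/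
theorem Real.log_one_add_inv_pos {y : ℝ} (hy : 0 < y) : 0 < Real.log (1 + 1 / y) :=
  Real.log_pos (lt_add_of_pos_right 1 (one_div_pos.2 hy))

theorem Real.hasDerivAt_log_one_add_inv {y : ℝ} (hy : 0 < y) :
    HasDerivAt (fun z : ℝ => Real.log (1 + 1 / z)) (-1 / (y * (y + 1))) y := by
  have h : HasDerivAt (fun z : ℝ => 1 + 1 / z) (-(y ^ 2)⁻¹) y := by
    simpa [one_div] using (hasDerivAt_inv hy.ne').const_add 1
  convert h.log (by positivity) using 1
  field_simp

theorem Real.inv_add_one_le_log_one_add_inv {y : ℝ} (hy : 0 < y) :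
    1 / (y + 1) ≤ Real.log (1 + 1 / y) := by
  have h := Real.one_sub_inv_le_log_of_pos (show 0 < 1 + 1 / y by positivity)
  convert h using 1
  field_simp
  ring

theorem Real.monotoneOn_mul_log_one_add_inv :
    MonotoneOn (fun y : ℝ => y * Real.log (1 + 1 / y)) (Set.Ioi 0) := by
  have hd : ∀ y ∈ Set.Ioi (0 : ℝ), HasDerivAt (fun y : ℝ => y * Real.log (1 + 1 / y))
      (Real.log (1 + 1 / y) - 1 / (y + 1)) y := by
    intro y hy
    have hy : 0 < y := hy
    refine ((hasDerivAt_id' y).fun_mul (Real.hasDerivAt_log_one_add_inv hy)).congr_deriv ?_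
    have h : y * (-1 / (y * (y + 1))) = -(1 / (y + 1)) := by field_simp
    rw [h]
    ring
  refine monotoneOn_of_deriv_nonneg (convex_Ioi 0)
    (fun y hy => (hd y hy).continuousAt.continuousWithinAt) ?_ ?_
  · rw [interior_Ioi]
    exact fun y hy => (hd y hy).differentiableAt.differentiableWithinAt
  · rw [interior_Ioi]
    intro y hy
    rw [(hd y hy).deriv]
    exact sub_nonneg.2 (Real.inv_add_one_le_log_one_add_inv hy)

theorem Real.hasDerivAt_sqrt_log_one_add_inv {y : ℝ} (hy : 0 < y) :
    HasDerivAt (fun z : ℝ => √(Real.log (1 + 1 / z)))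
      (-1 / (2 * (y * (y + 1) * √(Real.log (1 + 1 / y))))) y := by
  have hG := Real.log_one_add_inv_pos hy
  have hS := Real.sqrt_pos.2 hG
  convert (Real.hasDerivAt_log_one_add_inv hy).sqrt hG.ne' using 1
  field_simp

theorem Real.convexOn_sqrt_log_one_add_inv :
    ConvexOn ℝ (Set.Ioi 0) (fun y : ℝ => √(Real.log (1 + 1 / y))) := by
  refine MonotoneOn.convexOn_of_deriv (convex_Ioi 0)
    (fun y hy => (Real.hasDerivAt_sqrt_log_one_add_inv hy).continuousAt.continuousWithinAt) ?_ ?_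
  · rw [interior_Ioi]
    exact fun y hy =>
      (Real.hasDerivAt_sqrt_log_one_add_inv hy).differentiableAt.differentiableWithinAt
  · rw [interior_Ioi]
    intro y hy z hz hyz
    rw [(Real.hasDerivAt_sqrt_log_one_add_inv hy).deriv,
      (Real.hasDerivAt_sqrt_log_one_add_inv hz).deriv]
    have hmono := Real.monotoneOn_mul_log_one_add_inv hy hz hyz
    have hy : 0 < y := hy
    have hz : 0 < z := hz
    have hG := Real.log_one_add_inv_pos hy
    have hG' := Real.log_one_add_inv_pos hz
    have hS := Real.sqrt_pos.2 hG
    have hle : y * (y + 1) * √(Real.log (1 + 1 / y)) ≤ z * (z + 1) * √(Real.log (1 + 1 / z)) := by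
      refine (sq_le_sq₀ (by positivity) (by positivity)).1 ?_
      rw [mul_pow, mul_pow _ (√(Real.log (1 + 1 / z))), Real.sq_sqrt hG.le, Real.sq_sqrt hG'.le]
      calc (y * (y + 1)) ^ 2 * Real.log (1 + 1 / y)
          = y * (y + 1) ^ 2 * (y * Real.log (1 + 1 / y)) := by ring
        _ ≤ z * (z + 1) ^ 2 * (z * Real.log (1 + 1 / z)) := by
          have : 0 ≤ y * Real.log (1 + 1 / y) := by positivity
          exact mul_le_mul (by gcongr) hmono this (by positivity)
        _ = (z * (z + 1)) ^ 2 * Real.log (1 + 1 / z) := by ring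
    rw [neg_div, neg_div, neg_le_neg_iff]
    gcongr

/-- The graph of a convex function lies above each of its tangent lines. -/
theorem ConvexOn.tangent_le_of_hasDerivAt {s : Set ℝ} {f : ℝ → ℝ} {f' a b : ℝ}
    (hf : ConvexOn ℝ s f) (ha : a ∈ s) (hb : b ∈ s) (hd : HasDerivAt f f' a) :
    f a + f' * (b - a) ≤ f b := by
  rcases lt_trichotomy a b with h | rfl | h
  · have := hf.le_slope_of_hasDerivAt ha hb h hd
    rw [slope_def_field, le_div_iff₀ (sub_pos.2 h)] at this
    linarith
  · simp
  · have := hf.slope_le_of_hasDerivAt hb ha h hd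
    rw [slope_def_field, div_le_iff₀ (sub_pos.2 h)] at this
    linarith


/-- Inequality (33) of the paper: the first-order Taylor lower bound of the
jointly convex function `(x, y) ↦ (1/x) log(1 + 1/y)` at `(x₀, y₀)`:
`(1/x) log(1 + 1/y) ≥ a - b y - c x` with
`a = (2/x₀) log(1 + 1/y₀) + 1/(x₀ (y₀ + 1))`, `b = 1/(x₀ y₀ (y₀ + 1))`,
`c = (1/x₀²) log(1 + 1/y₀)`. -/
theorem fedfog_rate_lower_bound
    (x y x₀ y₀ : ℝ) (hx : 0 < x) (hy : 0 < y) (hx₀ : 0 < x₀) (hy₀ : 0 < y₀) :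
    (1 / x) * Real.log (1 + 1 / y)
      ≥ ((2 / x₀) * Real.log (1 + 1 / y₀) + 1 / (x₀ * (y₀ + 1)))
        - (1 / (x₀ * y₀ * (y₀ + 1))) * y
        - ((1 / x₀ ^ 2) * Real.log (1 + 1 / y₀)) * x := by
  have hG := Real.log_one_add_inv_pos hy
  have hG₀ := Real.log_one_add_inv_pos hy₀
  have htan := Real.convexOn_sqrt_log_one_add_inv.tangent_le_of_hasDerivAt
    (Set.mem_Ioi.2 hy₀) (Set.mem_Ioi.2 hy) (Real.hasDerivAt_sqrt_log_one_add_inv hy₀)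
  rw [← Real.sq_sqrt hG.le, ← Real.sq_sqrt hG₀.le]
  have hq := Real.sqrt_pos.2 hG₀
  generalize √(Real.log (1 + 1 / y)) = p at *
  generalize √(Real.log (1 + 1 / y₀)) = q at *
  have hlin : 2 * q ^ 2 + (y₀ - y) / (y₀ * (y₀ + 1)) ≤ 2 * p * q := by
    calc 2 * q ^ 2 + (y₀ - y) / (y₀ * (y₀ + 1))
        = 2 * q * (q + -1 / (2 * (y₀ * (y₀ + 1) * q)) * (y - y₀)) := by field_simp; ring
      _ ≤ 2 * q * p := by gcongr
      _ = 2 * p * q := by ring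
  have hamgm : 2 * p * q / x₀ ≤ 1 / x * p ^ 2 + 1 / x₀ ^ 2 * q ^ 2 * x := by
    have h : 1 / x * p ^ 2 + 1 / x₀ ^ 2 * q ^ 2 * x - 2 * p * q / x₀
        = (p - q * x / x₀) ^ 2 / x := by field_simp; ring
    have : 0 ≤ (p - q * x / x₀) ^ 2 / x := by positivity
    linarith
  have hdiv := div_le_div_of_nonneg_right hlin hx₀.le
  have hsplit : (2 * q ^ 2 + (y₀ - y) / (y₀ * (y₀ + 1))) / x₀
      = 2 / x₀ * q ^ 2 + 1 / (x₀ * (y₀ + 1)) - 1 / (x₀ * y₀ * (y₀ + 1)) * y := by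
    field_simp
    ring
  linarith
end
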